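/- The plane ℝ² can be written as a countable union of naively Haar null sets; in particular, the naively Haar null subsets of ℝ² do not form a σ-ideal. -/

import Mathlib

open MeasureTheory Set

/-- A set `X` in an additive abelian group `G` is naively Haar null if there is a Borel
probability measure `μ` such that `μ (g + X) = 0` for every `g`. -/
def IsNaivelyHaarNullAdd {G : Type*} [MeasurableSpace G] [AddGroup G] (X : Set G) : Prop :=
  ∃ μ : Measure G, IsProbabilityMeasure μ ∧
    ∀ g : G, μ ((fun x => g + x) '' X) = 0

open Cardinal in
/-- For uncountable `κ`, fewer than `κ` points generate fewer than `κ` points with coordinates in the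
subfield generated by their coordinates. -/
theorem mk_prod_subfield_closure_lt {κ : Cardinal.{0}} (hκ : ℵ₀ < κ) {s : Set (ℝ × ℝ)}
    (hs : #s < κ) :
    #{p : ℝ × ℝ | p.1 ∈ Subfield.closure (Prod.fst '' s ∪ Prod.snd '' s) ∧
      p.2 ∈ Subfield.closure (Prod.fst '' s ∪ Prod.snd '' s)} < κ := by
  set K := Subfield.closure (Prod.fst '' s ∪ Prod.snd '' s)
  have hκ' : ℵ₀ ≤ κ := hκ.le
  have hcoord : #(Prod.fst '' s ∪ Prod.snd '' s : Set ℝ) < κ :=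
    (mk_union_le _ _).trans_lt
      (add_lt_of_lt hκ' (mk_image_le.trans_lt hs) (mk_image_le.trans_lt hs))
  have hKlt : #K < κ := (Subfield.cardinalMk_closure_le_max _).trans_lt (max_lt hcoord hκ)
  have hle : #{p : ℝ × ℝ | p.1 ∈ K ∧ p.2 ∈ K} ≤ #(K × K) :=
    mk_le_of_injective (f := fun p => (⟨p.1.1, p.2.1⟩, ⟨p.1.2, p.2.2⟩)) fun p q h => by
      simp only [Prod.mk.injEq, Subtype.mk.injEq] at h
      exact Subtype.ext (Prod.ext h.1 h.2)
  refine hle.trans_lt ?_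
  rw [mk_prod]
  simp only [lift_id]
  exact mul_lt_of_lt hκ' hKlt hKlt

/-- Two lines of distinct integer slopes through points with coordinates in a subfield meet at a
point with coordinates in that subfield. -/
theorem mem_subfield_of_two_lines {K : Subfield ℝ} {x p q : ℝ × ℝ} {m n : ℕ} (hmn : m ≠ n)
    (hp : p.1 ∈ K ∧ p.2 ∈ K) (hq : q.1 ∈ K ∧ q.2 ∈ K)
    (hxp : x.2 - m * x.1 = p.2 - m * p.1) (hxq : x.2 - n * x.1 = q.2 - n * q.1) :
    x.1 ∈ K ∧ x.2 ∈ K := by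
  have hne : (n : ℝ) - m ≠ 0 := sub_ne_zero.2 (by exact_mod_cast hmn.symm)
  have h₁ : x.1 = ((p.2 - m * p.1) - (q.2 - n * q.1)) / (n - m) := by
    rw [eq_div_iff hne]; linear_combination hxp - hxq
  have hx₁ : x.1 ∈ K := by
    rw [h₁]
    exact div_mem (sub_mem (sub_mem hp.2 (mul_mem (natCast_mem K m) hp.1))
      (sub_mem hq.2 (mul_mem (natCast_mem K n) hq.1)))
      (sub_mem (natCast_mem K n) (natCast_mem K m))
  refine ⟨hx₁, ?_⟩
  have h₂ : x.2 = p.2 - m * p.1 + m * x.1 := by linear_combination hxp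
  rw [h₂]
  exact add_mem (sub_mem hp.2 (mul_mem (natCast_mem K m) hp.1)) (mul_mem (natCast_mem K m) hx₁)

/-- On a countable set, an injective colouring can avoid finitely many colours at each point. -/
theorem exists_injOn_notMem_of_countable {α : Type*} {A : Set α} (hA : A.Countable)
    (F : α → Set ℕ) (hF : ∀ x, (F x).Finite) :
    ∃ f : α → ℕ, (∀ x ∈ A, f x ∉ F x) ∧ InjOn f A := by
  obtain ⟨e, he⟩ := countable_iff_exists_injOn.1 hA
  have hex : ∀ x, ∃ k, Nat.pair (e x) k ∉ F x := fun x => by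
    by_contra! h
    refine Set.infinite_of_injective_forall_mem (f := fun k => Nat.pair (e x) k) ?_ h (hF x)
    intro k l hkl
    exact (Nat.pair_eq_pair.1 hkl).2
  choose k hk using hex
  exact ⟨fun x => Nat.pair (e x) (k x), fun x _ => hk x,
    fun x hx y hy h => he hx hy (Nat.pair_eq_pair.1 h).1⟩

open Cardinal Ordinal in
/-- **Davies' theorem**, with finitely many forbidden colours at each point: a planar set can be
coloured by `ℕ` so that a line of slope `n` contains at most one point of colour `n`. -/
theorem exists_coloring_lines (A : Set (ℝ × ℝ)) (F : ℝ × ℝ → Set ℕ) (hF : ∀ x, (F x).Finite) :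
    ∃ f : ℝ × ℝ → ℕ, (∀ x ∈ A, f x ∉ F x) ∧ ∀ x ∈ A, ∀ y ∈ A, f x = f y →
      x.2 - f x * x.1 = y.2 - f x * y.1 → x = y := by
  induction hκ : #A using WellFoundedLT.induction generalizing A F with
  | ind κ ih =>
  rcases le_or_gt κ ℵ₀ with hle | hlt
  · obtain ⟨f, hf, hinj⟩ := exists_injOn_notMem_of_countable
      (le_aleph0_iff_set_countable.1 (hκ.trans_le hle)) F hF
    exact ⟨f, hf, fun x hx y hy h _ => hinj hx hy h⟩
  obtain ⟨ι, _, _, hord, ⟨e⟩⟩ : ∃ (ι : Type) (_ : LinearOrder ι) (_ : WellFoundedLT ι),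
      ord #ι = typeLT ι ∧ Nonempty (A ≃ ι) := by
    obtain ⟨lin, wf, h⟩ := exists_ord_eq_type_lt A
    exact ⟨A, lin, wf, h, ⟨Equiv.refl _⟩⟩
  have hι : #ι = κ := e.cardinal_eq.symm.trans hκ
  have : Nonempty ι := mk_ne_zero_iff.1 (hι ▸ (aleph0_pos.trans hlt).ne')
  let seg : ι → Set (ℝ × ℝ) := fun a => (fun i => (e.symm i : ℝ × ℝ)) '' Iic a
  let K : ι → Subfield ℝ := fun a => Subfield.closure (Prod.fst '' seg a ∪ Prod.snd '' seg a)
  let S : ι → Set (ℝ × ℝ) := fun a => {p | p.1 ∈ K a ∧ p.2 ∈ K a}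
  have hKmono : Monotone K := fun a b hab => Subfield.closure_mono <| by
    have : seg a ⊆ seg b := image_mono (Iic_subset_Iic.2 hab)
    exact union_subset_union (image_mono this) (image_mono this)
  have hSmono : Monotone S := fun a b hab p hp => ⟨hKmono hab hp.1, hKmono hab hp.2⟩
  have hScard : ∀ a, #(S a) < κ := fun a => by
    refine mk_prod_subfield_closure_lt hlt (mk_image_le.trans_lt ?_)
    exact (mk_Iic_lt a hord (hι ▸ hlt.le)).trans_eq hι
  have hself : ∀ a : ι, (e.symm a : ℝ × ℝ) ∈ S a := fun a =>
    ⟨Subfield.subset_closure (Or.inl ⟨e.symm a, ⟨a, self_mem_Iic, rfl⟩, rfl⟩),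
      Subfield.subset_closure (Or.inr ⟨e.symm a, ⟨a, self_mem_Iic, rfl⟩, rfl⟩)⟩
  let B : ι → Set (ℝ × ℝ) := fun a => {x | x ∈ A ∧ x ∈ S a ∧ ∀ b < a, x ∉ S b}
  have hlevel : ∀ x ∈ A, ∃ a, x ∈ B a := fun x hx => by
    obtain ⟨a, ha, hmin⟩ := WellFounded.has_min (wellFounded_lt (α := ι)) {a | x ∈ S a}
      ⟨e ⟨x, hx⟩, by simpa using hself (e ⟨x, hx⟩)⟩
    exact ⟨a, hx, ha, fun b hb hxb => hmin b hxb hb⟩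
  let T : ι → ℝ × ℝ → Set ℕ := fun a x =>
    {n | (∀ b < a, x ∉ S b) ∧ ∃ b < a, ∃ p ∈ S b, x.2 - n * x.1 = p.2 - n * p.1}
  have hT : ∀ a x, (T a x).Finite := fun a x => Set.Subsingleton.finite <| by
    rintro m ⟨hx, b, hb, p, hp, hxp⟩ n ⟨-, c, hc, q, hq, hxq⟩
    by_contra hmn
    exact hx (max b c) (max_lt hb hc) (mem_subfield_of_two_lines hmn
      (hSmono (le_max_left b c) hp) (hSmono (le_max_right b c) hq) hxp hxq)
  choose g hgF hg using fun a => ih #(B a)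
    ((mk_le_mk_of_subset fun x hx => hx.2.1).trans_lt (hScard a)) (B a)
    (fun x => F x ∪ T a x) (fun x => (hF x).union (hT a x)) rfl
  choose! lev hlev using hlevel
  have hnot : ∀ x ∈ A, ∀ y ∈ A, lev y < lev x →
      x.2 - g (lev x) x * x.1 ≠ y.2 - g (lev x) x * y.1 := fun x hx y hy hyx h =>
    hgF (lev x) x (hlev x hx)
      (Or.inr ⟨(hlev x hx).2.2, lev y, hyx, y, (hlev y hy).2.1, h⟩)
  refine ⟨fun x => g (lev x) x, fun x hx h => hgF _ x (hlev x hx) (Or.inl h), ?_⟩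
  intro x hx y hy hxy hline
  rcases lt_trichotomy (lev x) (lev y) with h | h | h
  · exact (hnot y hy x hx h (by simpa only [hxy] using hline.symm)).elim
  · exact hg (lev x) x (hlev x hx) y (h ▸ hlev y hy) (by simpa only [← h] using hxy) hline
  · exact (hnot x hx y hy h hline).elim

/-- A planar set meeting every line of slope `c` in at most one point is naively Haar null. -/
theorem isNaivelyHaarNullAdd_of_injOn {X : Set (ℝ × ℝ)} {c : ℝ}
    (hX : InjOn (fun x : ℝ × ℝ => x.2 - c * x.1) X) : IsNaivelyHaarNullAdd X := by
  have hmeas : Measurable fun t : ℝ => (t, c * t) := by fun_prop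
  let ν : Measure ℝ := volume.restrict (Icc 0 1)
  have : IsProbabilityMeasure ν := ⟨by simp [ν]⟩
  refine ⟨ν.map fun t => (t, c * t), Measure.isProbabilityMeasure_map hmeas.aemeasurable, ?_⟩
  intro g
  let Y : Set (ℝ × ℝ) := {y ∈ (fun x => g + x) '' X | y.2 = c * y.1}
  have hY : Y.Subsingleton := by
    rintro _ ⟨⟨x, hx, rfl⟩, hxl⟩ _ ⟨⟨y, hy, rfl⟩, hyl⟩
    simp only [Prod.fst_add, Prod.snd_add] at hxl hyl
    have : x = y := hX hx hy (by simp only; linear_combination hxl - hyl)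
    rw [this]
  have hYm : MeasurableSet Y := hY.measurableSet
  have hline : MeasurableSet {y : ℝ × ℝ | y.2 ≠ c * y.1} :=
    (measurableSet_eq_fun measurable_snd (measurable_fst.const_mul c)).compl
  refine measure_mono_null (t := Y ∪ {y | y.2 ≠ c * y.1}) (fun y hy => ?_) ?_
  · by_cases h : y.2 = c * y.1
    · exact Or.inl ⟨hy, h⟩
    · exact Or.inr h
  · refine measure_union_null ?_ ?_
    · rw [Measure.map_apply hmeas hYm]
      refine Set.Subsingleton.measure_zero (fun s hs t ht => ?_) _
      exact congrArg Prod.fst (hY hs ht)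
    · rw [Measure.map_apply hmeas hline]
      simp

/-- The whole group is not naively Haar null. -/
theorem not_isNaivelyHaarNullAdd_univ {G : Type*} [MeasurableSpace G] [AddGroup G] :
    ¬ IsNaivelyHaarNullAdd (Set.univ : Set G) := by
  rintro ⟨μ, _, h⟩
  have h₀ := h 0
  simp at h₀

/-- The plane is a countable union of naively Haar null sets; since the whole plane is not
naively Haar null, the naively Haar null subsets of the plane do not form a σ-ideal. -/
theorem plane_countable_union_of_naivelyHaarNull :
    ∃ A : ℕ → Set (ℝ × ℝ), (∀ n : ℕ, IsNaivelyHaarNullAdd (A n)) ∧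
      (⋃ n : ℕ, A n) = Set.univ ∧
      ¬ IsNaivelyHaarNullAdd (Set.univ : Set (ℝ × ℝ)) := by
  obtain ⟨f, -, hf⟩ := exists_coloring_lines univ (fun _ => ∅) fun _ => finite_empty
  refine ⟨fun n => f ⁻¹' {n}, fun n => ?_, ?_, not_isNaivelyHaarNullAdd_univ⟩
  · refine isNaivelyHaarNullAdd_of_injOn (c := n) ?_
    rintro x rfl y hy hxy
    exact hf x (mem_univ x) y (mem_univ y) hy.symm hxy
  · exact iUnion_eq_univ_iff.2 fun x => ⟨f x, rfl⟩
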